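/- Radial Loewner ordinary differential equation: let p : 𝔻 × [0,∞) → ℂ be such that for almost every t ≥ 0 the map z ↦ p(z,t) is holomorphic on 𝔻 with Re p(z,t) > 0 and p(0,t) = 1, and for every z ∈ 𝔻 the map t ↦ p(z,t) is measurable. Then for every s ≥ 0 there exists a unique family (g_{s,t})_{t≥s} of holomorphic maps g_{s,t} : 𝔻 → 𝔻, with t ↦ g_{s,t}(z) locally absolutely continuous for each z, solving ∂_t g_{s,t}(z) = −g_{s,t}(z)·p(g_{s,t}(z), t) for almost every t ≥ s with g_{s,s}(z) = z. Moreover every g_{s,t} is injective, and g_{s,u} = g_{t,u} ∘ g_{s,t} for all 0 ≤ s ≤ t ≤ u. -/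

import Mathlib

open Filter Topology Set MeasureTheory

/-- `g` solves the radial Loewner ODE for the Herglotz function `p` with initial
time `s`: each `g t` is a holomorphic self-map of the unit disc, and for every `z` in
the disc, `t ↦ g t z` satisfies the integral form of
`∂ₜ g_t(z) = −g_t(z)·p(g_t(z), t)`, `g_s(z) = z`. -/
def SolvesRadialLoewner (p : ℂ → ℝ → ℂ) (s : ℝ) (g : ℝ → ℂ → ℂ) : Prop :=
  (∀ t : ℝ, s ≤ t →
    Set.MapsTo (g t) (Metric.ball (0 : ℂ) 1) (Metric.ball (0 : ℂ) 1) ∧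
    DifferentiableOn ℂ (g t) (Metric.ball (0 : ℂ) 1)) ∧
  (∀ z ∈ Metric.ball (0 : ℂ) 1, ∀ t : ℝ, s ≤ t →
    g t z = z - ∫ τ in s..t, g τ z * p (g τ z) τ)

open Metric Complex

/-- A Herglotz family: a Carathéodory function on the unit disc, for all times. -/
structure IsHerglotzFamily (p : ℂ → ℝ → ℂ) : Prop where
  differentiableOn : ∀ t, DifferentiableOn ℂ (fun z => p z t) (ball (0 : ℂ) 1)
  re_pos : ∀ t, ∀ z ∈ ball (0 : ℂ) 1, 0 < (p z t).re
  map_zero : ∀ t, p 0 t = 1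
  measurable : ∀ z ∈ ball (0 : ℂ) 1, Measurable fun t => p z t

lemma Measurable.intervalIntegrable_of_norm_le {f : ℝ → ℂ} {M : ℝ} (hf : Measurable f)
    (hM : ∀ x, ‖f x‖ ≤ M) (a b : ℝ) : IntervalIntegrable f volume a b :=
  (intervalIntegrable_const (c := M)).mono_fun hf.aestronglyMeasurable
    (.of_forall fun x => (hM x).trans (le_abs_self M))

lemma Complex.norm_exp_neg_sub_exp_neg_le {a b : ℂ} (ha : 0 ≤ a.re) (hb : 0 ≤ b.re) :
    ‖exp (-a) - exp (-b)‖ ≤ ‖a - b‖ := by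
  have hd (z : ℂ) : HasDerivAt (fun z => exp (-z)) (-exp (-z)) z := by
    simpa using (hasDerivAt_neg z).cexp
  have := (convex_halfSpace_re_ge 0).norm_image_sub_le_of_norm_deriv_le
    (f := fun z : ℂ => exp (-z)) (C := 1) (fun z _ => (hd z).differentiableAt)
    (fun z hz => ?_) hb ha
  · simpa using this
  · rw [(hd z).deriv, norm_neg, Complex.norm_exp]
    simpa using hz

/-- The exponential of a primitive of a bounded measurable function satisfies the linear
equation in integral form. -/
lemma exp_neg_integral_eq_one_sub_integral {q : ℝ → ℂ} {M : ℝ} (hq : Measurable q)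
    (hM : ∀ x, ‖q x‖ ≤ M) (hre : ∀ x, 0 ≤ (q x).re) {s t : ℝ} (hst : s ≤ t) :
    exp (-∫ τ in s..t, q τ) = 1 - ∫ τ in s..t, exp (-∫ σ in s..τ, q σ) * q τ := by
  have hint := hq.intervalIntegrable_of_norm_le hM
  set P : ℝ → ℂ := fun τ => ∫ σ in s..τ, q σ with hP
  have hPc : Continuous P := intervalIntegral.continuous_primitive hint s
  have hPre : ∀ τ, s ≤ τ → 0 ≤ (P τ).re := fun τ hτ => by
    have : (P τ).re = ∫ σ in s..τ, (q σ).re :=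
      (reCLM.intervalIntegral_comp_comm (hint s τ)).symm
    rw [this]
    exact intervalIntegral.integral_nonneg hτ fun σ _ => hre σ
  have hPlip : ∀ x y, ‖P x - P y‖ ≤ M * |x - y| := fun x y => by
    rw [hP, intervalIntegral.integral_interval_sub_left (hint _ _) (hint _ _)]
    exact intervalIntegral.norm_integral_le_of_norm_le_const fun σ _ => hM σ
  have hM0 : 0 ≤ M := (norm_nonneg _).trans (hM 0)
  set k : ℝ → ℂ := fun τ => exp (-P τ) * q τ with hk
  have hkint : ∀ a b, IntervalIntegrable k volume a b := fun a b =>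
    (hint a b).continuousOn_mul (by fun_prop)
  have hexp : ∀ τ, s ≤ τ → ‖exp (-P τ)‖ ≤ 1 := fun τ hτ => by
    rw [Complex.norm_exp]
    simpa using hPre τ hτ
  set φ : ℝ → ℂ := fun τ => exp (-P τ) + ∫ σ in s..τ, k σ with hφ
  have hlip : LipschitzOnWith (2 * M).toNNReal φ (uIcc s t) := by
    refine LipschitzOnWith.of_dist_le_mul fun x hx y hy => ?_
    rw [uIcc_of_le hst] at hx hy
    rw [dist_eq_norm, Real.dist_eq]
    have h₁ := (norm_exp_neg_sub_exp_neg_le (hPre x hx.1) (hPre y hy.1)).trans (hPlip x y)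
    have h₂ : ‖(∫ σ in s..x, k σ) - ∫ σ in s..y, k σ‖ ≤ M * |x - y| := by
      rw [intervalIntegral.integral_interval_sub_left (hkint _ _) (hkint _ _)]
      refine intervalIntegral.norm_integral_le_of_norm_le_const fun σ hσ => ?_
      have hsσ : s ≤ σ := by
        have := (uIoc_subset_uIcc hσ).1
        exact (le_min hy.1 hx.1).trans this
      rw [hk, norm_mul]
      exact (mul_le_mul (hexp σ hsσ) (hM σ) (norm_nonneg _) zero_le_one).trans (one_mul M).le
    calc ‖φ x - φ y‖ = ‖(exp (-P x) - exp (-P y)) +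
          ((∫ σ in s..x, k σ) - ∫ σ in s..y, k σ)‖ := by rw [hφ]; ring_nf
      _ ≤ M * |x - y| + M * |x - y| := (norm_add_le _ _).trans (add_le_add h₁ h₂)
      _ = _ := by rw [Real.coe_toNNReal _ (by positivity)]; ring
  have hderiv : ∀ᵐ x, x ∈ uIcc s t → HasDerivAt φ 0 x := by
    filter_upwards [(hint s t).ae_hasDerivAt_integral, (hkint s t).ae_hasDerivAt_integral]
      with x hx₁ hx₂ hx
    have h₁ := (hx₁ hx s left_mem_uIcc).neg.cexp
    have h₂ := hx₂ hx s left_mem_uIcc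
    have h₃ : HasDerivAt φ (exp (-P x) * -q x + k x) x := h₁.add h₂
    rwa [show exp (-P x) * -q x + k x = 0 by rw [hk]; ring] at h₃
  obtain ⟨C, hC⟩ := hlip.absolutelyContinuousOnInterval.const_of_ae_hasDerivAt_zero hderiv
  have h := (hC t right_mem_uIcc).trans (hC s left_mem_uIcc).symm
  simp only [hφ, hP, intervalIntegral.integral_same, neg_zero, exp_zero, add_zero] at h
  exact eq_sub_of_add_eq h

/-- Holomorphic dependence on a parameter of the integral of a locally bounded family. -/
lemma differentiableOn_intervalIntegral_of_norm_le {F : ℂ → ℝ → ℂ}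
    (hd : ∀ t, DifferentiableOn ℂ (fun z => F z t) (ball (0 : ℂ) 1))
    (hm : ∀ z ∈ ball (0 : ℂ) 1, Measurable (F z)) {M : ℝ → ℝ}
    (hM : ∀ r < 1, ∀ z, ‖z‖ ≤ r → ∀ t, ‖F z t‖ ≤ M r) (a b : ℝ) :
    DifferentiableOn ℂ (fun z => ∫ t in a..b, F z t) (ball (0 : ℂ) 1) := by
  intro z₀ hz₀
  have hz₁ : ‖z₀‖ < 1 := by simpa using hz₀
  set ε := (1 - ‖z₀‖) / 3 with hε
  have hε0 : 0 < ε := by rw [hε]; linarith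
  have hsub : ∀ z ∈ ball z₀ ε, ‖z‖ ≤ ‖z₀‖ + ε := fun z hz => by
    have := norm_le_norm_add_norm_sub' z z₀
    rw [mem_ball, dist_eq_norm] at hz
    linarith
  have hat : ∀ t, ∀ z ∈ ball (0 : ℂ) 1, DifferentiableAt ℂ (fun z => F z t) z := fun t z hz =>
    (hd t).differentiableAt (isOpen_ball.mem_nhds hz)
  have hmem : ∀ z ∈ ball z₀ ε, z ∈ ball (0 : ℂ) 1 := fun z hz => by
    have := hsub z hz
    rw [mem_ball_zero_iff]
    linarith
  refine (intervalIntegral.hasDerivAt_integral_of_dominated_loc_of_deriv_le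
    (F' := fun z t => deriv (fun z => F z t) z) (bound := fun _ => M (‖z₀‖ + 2 * ε) / ε)
    (ball_mem_nhds z₀ hε0) ?_ ?_ ?_ ?_ ?_ ?_).2.differentiableAt.differentiableWithinAt
  · filter_upwards [ball_mem_nhds z₀ hε0] with z hz
    exact (hm z (hmem z hz)).aestronglyMeasurable
  · exact (hm z₀ hz₀).intervalIntegrable_of_norm_le (hM _ hz₁ z₀ le_rfl) a b
  · refine Measurable.aestronglyMeasurable ?_
    obtain ⟨u, -, hu0, hu⟩ := exists_seq_strictAnti_tendsto' hε0
    refine measurable_of_tendsto_metrizable (f := fun n t =>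
      ((u n : ℂ))⁻¹ • (F (z₀ + u n) t - F z₀ t)) (fun n => ?_) ?_
    · refine ((hm _ (hmem _ ?_)).sub (hm _ hz₀)).const_smul ((u n : ℂ))⁻¹
      simpa [abs_of_pos (hu0 n).1] using (hu0 n).2
    · rw [tendsto_pi_nhds]
      intro t
      refine ((hat t z₀ hz₀).hasDerivAt.tendsto_slope_zero).comp ?_
      refine tendsto_nhdsWithin_iff.2 ⟨?_, .of_forall fun n => ?_⟩
      · exact_mod_cast (continuous_ofReal.tendsto 0).comp hu
      · simpa using (hu0 n).1.ne'
  · refine .of_forall fun t _ z hz => ?_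
    have hle : ∀ w ∈ closedBall z ε, ‖w‖ ≤ ‖z₀‖ + 2 * ε := fun w hw => by
      have := norm_le_norm_add_norm_sub' w z
      rw [mem_closedBall, dist_eq_norm] at hw
      linarith [hsub z hz]
    refine norm_deriv_le_of_forall_mem_sphere_norm_le hε0 ?_ fun w hw =>
      hM _ (by linarith) w (hle w (sphere_subset_closedBall hw)) t
    refine ((hd t).mono fun w hw => ?_).diffContOnCl
    rw [mem_ball_zero_iff]
    have := hle w (closure_ball_subset_closedBall hw)
    linarith
  · exact intervalIntegrable_const
  · exact .of_forall fun t _ z hz => (hat t z (hmem z hz)).hasDerivAt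

/-- Grönwall's inequality in integral form, with zero initial value. -/
lemma eq_zero_of_le_mul_integral {u : ℝ → ℝ} {K a b : ℝ} (hu : Continuous u) (h0 : ∀ t, 0 ≤ u t)
    (hle : ∀ t ∈ Icc a b, u t ≤ K * ∫ τ in a..t, u τ) : ∀ t ∈ Icc a b, u t = 0 := by
  have hz := eq_zero_of_abs_deriv_le_mul_abs_self_of_eq_zero_right (K := K)
    (f := fun t => ∫ τ in a..t, u τ) (f' := u) (a := a) (b := b)
    (intervalIntegral.continuous_primitive (fun _ _ => hu.intervalIntegrable _ _) a).continuousOn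
    (fun x _ => (hu.integral_hasStrictDerivAt a x).hasDerivAt.hasDerivWithinAt) (by simp)
    (fun x hx => by
      have hpos : 0 ≤ ∫ τ in a..x, u τ :=
        intervalIntegral.integral_nonneg hx.1 fun τ _ => h0 τ
      rw [Real.norm_of_nonneg (h0 x), Real.norm_of_nonneg hpos]
      exact hle x ⟨hx.1, hx.2.le⟩)
  intro t ht
  refine le_antisymm ?_ (h0 t)
  simpa [hz t ht] using hle t ht

namespace IsHerglotzFamily

variable {p : ℂ → ℝ → ℂ}

lemma norm_le (hp : IsHerglotzFamily p) {r : ℝ} (hr : r < 1) {z : ℂ} (hz : ‖z‖ ≤ r) (t : ℝ) :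
    ‖p z t‖ ≤ 4 / (1 - r) := by
  have hz1 : ‖z‖ < 1 := hz.trans_lt hr
  have h := borelCaratheodory (f := fun z => -p z t) (M := 1) (R := 1) one_pos
    (hp.differentiableOn t).neg
    (fun w hw => by simpa using (by linarith [hp.re_pos t w hw] : -(p w t).re ≤ 1))
    one_pos (mem_ball_zero_iff.2 hz1)
  simp only [norm_neg, hp.map_zero, norm_one] at h
  rw [← add_div] at h
  refine h.trans (div_le_div₀ (by norm_num) (by linarith) (by linarith) (by linarith))

lemma norm_sub_le (hp : IsHerglotzFamily p) {r : ℝ} (hr : r < 1) {z w : ℂ} (hz : ‖z‖ ≤ r)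
    (hw : ‖w‖ ≤ r) (t : ℝ) : ‖p z t - p w t‖ ≤ 16 / (1 - r) ^ 2 * ‖z - w‖ := by
  have hr0 : 0 < (1 - r) / 2 := by linarith
  refine (convex_closedBall (0 : ℂ) r).norm_image_sub_le_of_norm_deriv_le
    (f := fun z => p z t) (fun x hx => ?_) (fun x hx => ?_)
    (mem_closedBall_zero_iff.2 hw) (mem_closedBall_zero_iff.2 hz)
  · refine (hp.differentiableOn t).differentiableAt (isOpen_ball.mem_nhds ?_)
    rw [mem_closedBall_zero_iff] at hx
    exact mem_ball_zero_iff.2 (hx.trans_lt hr)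
  · rw [mem_closedBall_zero_iff] at hx
    have hle : ∀ y ∈ closedBall x ((1 - r) / 2), ‖y‖ ≤ (1 + r) / 2 := fun y hy => by
      have := norm_le_norm_add_norm_sub' y x
      rw [mem_closedBall, dist_eq_norm] at hy
      linarith
    have := norm_deriv_le_of_forall_mem_sphere_norm_le (f := fun z => p z t) hr0
      (DifferentiableOn.diffContOnCl ((hp.differentiableOn t).mono fun y hy => by
        rw [mem_ball_zero_iff]
        linarith [hle y (closure_ball_subset_closedBall hy)]))
      (fun y hy => hp.norm_le (by linarith) (hle y (sphere_subset_closedBall hy)) t)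
    refine this.trans_eq ?_
    have : 1 - r ≠ 0 := by linarith
    rw [show 1 - (1 + r) / 2 = (1 - r) / 2 by ring]
    field_simp
    norm_num

lemma measurable_comp (hp : IsHerglotzFamily p) {w : ℝ → ℂ} (hw : Measurable w)
    (hw1 : ∀ t, ‖w t‖ < 1) : Measurable fun t => p (w t) t := by
  have h := measurable_uncurry_of_continuous_of_measurable (ι := ball (0 : ℂ) 1)
    (u := fun z t => p z t)
    (fun t => continuousOn_iff_continuous_domRestrict.1 (hp.differentiableOn t).continuousOn)
    (fun z => hp.measurable z z.2)
  exact h.comp ((hw.subtype_mk (h := fun t => mem_ball_zero_iff.2 (hw1 t))).prodMk measurable_id)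

lemma intervalIntegrable_comp (hp : IsHerglotzFamily p) {w : ℝ → ℂ} (hw : Measurable w) {r : ℝ}
    (hr : r < 1) (hwr : ∀ t, ‖w t‖ ≤ r) (a b : ℝ) :
    IntervalIntegrable (fun t => p (w t) t) volume a b :=
  (hp.measurable_comp hw fun t => (hwr t).trans_lt hr).intervalIntegrable_of_norm_le
    (fun t => hp.norm_le hr (hwr t) t) a b

lemma intervalIntegrable_mul_comp (hp : IsHerglotzFamily p) {w : ℝ → ℂ} (hw : Measurable w)
    {r : ℝ} (hr : r < 1) (hwr : ∀ t, ‖w t‖ ≤ r) (a b : ℝ) :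
    IntervalIntegrable (fun t => w t * p (w t) t) volume a b := by
  refine (hw.mul (hp.measurable_comp hw fun t => (hwr t).trans_lt hr)).intervalIntegrable_of_norm_le
    (M := 1 * (4 / (1 - r))) (fun t => ?_) a b
  rw [Pi.mul_apply, norm_mul]
  exact mul_le_mul ((hwr t).trans hr.le) (hp.norm_le hr (hwr t) t) (norm_nonneg _) zero_le_one

/-- Two solutions with values in a compact part of the disc separate at most at a rate
proportional to their distance. -/
lemma exists_norm_sub_sub_le (hp : IsHerglotzFamily p) {r a b : ℝ} (hr : r < 1) {v w : ℝ → ℂ}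
    (hv : Continuous v) (hw : Continuous w) (hvr : ∀ t, ‖v t‖ ≤ r) (hwr : ∀ t, ‖w t‖ ≤ r)
    (hveq : ∀ t ∈ Icc a b, v t = v a - ∫ τ in a..t, v τ * p (v τ) τ)
    (hweq : ∀ t ∈ Icc a b, w t = w a - ∫ τ in a..t, w τ * p (w τ) τ) :
    ∃ K : ℝ, ∀ x ∈ Icc a b, ∀ y ∈ Icc a b, x ≤ y →
      ‖(v y - w y) - (v x - w x)‖ ≤ K * ∫ τ in x..y, ‖v τ - w τ‖ := by
  refine ⟨4 / (1 - r) + 16 / (1 - r) ^ 2, fun x hx y hy hxy => ?_⟩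
  have hvi := hp.intervalIntegrable_mul_comp hv.measurable hr hvr
  have hwi := hp.intervalIntegrable_mul_comp hw.measurable hr hwr
  have key : (v y - w y) - (v x - w x)
      = ∫ τ in x..y, (w τ * p (w τ) τ - v τ * p (v τ) τ) := by
    rw [intervalIntegral.integral_sub (hwi _ _) (hvi _ _),
      ← intervalIntegral.integral_interval_sub_left (hwi a y) (hwi a x),
      ← intervalIntegral.integral_interval_sub_left (hvi a y) (hvi a x),
      hveq x hx, hveq y hy, hweq x hx, hweq y hy]
    ring
  rw [key, ← intervalIntegral.integral_const_mul]
  refine intervalIntegral.norm_integral_le_of_norm_le hxy (.of_forall fun τ _ => ?_)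
    (Continuous.intervalIntegrable (by fun_prop) _ _)
  calc ‖w τ * p (w τ) τ - v τ * p (v τ) τ‖
      = ‖(w τ - v τ) * p (w τ) τ + v τ * (p (w τ) τ - p (v τ) τ)‖ := by ring_nf
    _ ≤ ‖w τ - v τ‖ * ‖p (w τ) τ‖ + ‖v τ‖ * ‖p (w τ) τ - p (v τ) τ‖ := by
      simpa only [norm_mul] using
        norm_add_le ((w τ - v τ) * p (w τ) τ) (v τ * (p (w τ) τ - p (v τ) τ))
    _ ≤ ‖w τ - v τ‖ * (4 / (1 - r)) + 1 * (16 / (1 - r) ^ 2 * ‖w τ - v τ‖) := by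
      gcongr
      · exact hp.norm_le hr (hwr τ) τ
      · exact (hvr τ).trans hr.le
      · exact hp.norm_sub_le hr (hwr τ) (hvr τ) τ
    _ = _ := by rw [norm_sub_rev]; ring

lemma eqOn_of_eq_left (hp : IsHerglotzFamily p) {r a b : ℝ} (hr : r < 1) {v w : ℝ → ℂ}
    (hv : Continuous v) (hw : Continuous w) (hvr : ∀ t, ‖v t‖ ≤ r) (hwr : ∀ t, ‖w t‖ ≤ r)
    (hveq : ∀ t ∈ Icc a b, v t = v a - ∫ τ in a..t, v τ * p (v τ) τ)
    (hweq : ∀ t ∈ Icc a b, w t = w a - ∫ τ in a..t, w τ * p (w τ) τ)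
    (h : v a = w a) : EqOn v w (Icc a b) := by
  obtain ⟨K, hK⟩ := hp.exists_norm_sub_sub_le hr hv hw hvr hwr hveq hweq
  intro t ht
  have h0 := eq_zero_of_le_mul_integral (u := fun t => ‖v t - w t‖) (a := a) (b := b) (K := K)
    (by fun_prop) (fun _ => norm_nonneg _)
    (fun t ht => by simpa [h] using hK a ⟨le_rfl, ht.1.trans ht.2⟩ t ht ht.1) t ht
  exact sub_eq_zero.1 (norm_eq_zero.1 h0)

lemma eq_left_of_eq_right (hp : IsHerglotzFamily p) {r a b : ℝ} (hab : a ≤ b) (hr : r < 1)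
    {v w : ℝ → ℂ}
    (hv : Continuous v) (hw : Continuous w) (hvr : ∀ t, ‖v t‖ ≤ r) (hwr : ∀ t, ‖w t‖ ≤ r)
    (hveq : ∀ t ∈ Icc a b, v t = v a - ∫ τ in a..t, v τ * p (v τ) τ)
    (hweq : ∀ t ∈ Icc a b, w t = w a - ∫ τ in a..t, w τ * p (w τ) τ)
    (h : v b = w b) : v a = w a := by
  obtain ⟨K, hK⟩ := hp.exists_norm_sub_sub_le hr hv hw hvr hwr hveq hweq
  have h0 := eq_zero_of_le_mul_integral (u := fun x => ‖v (b - x) - w (b - x)‖) (a := 0)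
    (b := b - a) (K := K) (by fun_prop) (fun _ => norm_nonneg _)
    (fun x hx => by
      have := hK (b - x) ⟨by linarith [hx.2], by linarith [hx.1]⟩ b ⟨hab, le_rfl⟩
        (by linarith [hx.1])
      rw [intervalIntegral.integral_comp_sub_left (fun τ => ‖v τ - w τ‖) b, sub_zero]
      rwa [h, sub_self, zero_sub, norm_neg] at this)
    (b - a) ⟨by linarith, le_rfl⟩
  simpa [sub_eq_zero] using h0

end IsHerglotzFamily

/-- Picard iterates for the radial Loewner equation in exponential form
`g_t(z) = z exp (-∫ p(g_τ(z), τ) dτ)`, frozen before the initial time `s`. -/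
noncomputable def loewnerPicard (p : ℂ → ℝ → ℂ) (s : ℝ) : ℕ → ℝ → ℂ → ℂ
  | 0 => fun _ z => z
  | n + 1 => fun t z => z * exp (-∫ τ in s..max s t, p (loewnerPicard p s n τ z) τ)

/-- The limit of the Picard iterates, written as a telescoping series. -/
noncomputable def loewnerFlow (p : ℂ → ℝ → ℂ) (s t : ℝ) (z : ℂ) : ℂ :=
  z + ∑' n, (loewnerPicard p s (n + 1) t z - loewnerPicard p s n t z)

namespace IsHerglotzFamily

variable {p : ℂ → ℝ → ℂ}

lemma re_integral_comp_nonneg (hp : IsHerglotzFamily p) {w : ℝ → ℂ} (hw : Measurable w) {r : ℝ}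
    (hr : r < 1) (hwr : ∀ t, ‖w t‖ ≤ r) {s t : ℝ} (hst : s ≤ t) :
    0 ≤ (∫ τ in s..t, p (w τ) τ).re := by
  have : (∫ τ in s..t, p (w τ) τ).re = ∫ τ in s..t, (p (w τ) τ).re :=
    (reCLM.intervalIntegral_comp_comm (hp.intervalIntegrable_comp hw hr hwr s t)).symm
  rw [this]
  exact intervalIntegral.integral_nonneg hst fun τ _ =>
    (hp.re_pos τ _ (mem_ball_zero_iff.2 ((hwr τ).trans_lt hr))).le

/-- One step of the Picard iteration is continuous in time and does not increase the modulus. -/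
lemma continuous_and_norm_le_of_picard_step (hp : IsHerglotzFamily p) {z : ℂ} (hz : ‖z‖ < 1)
    {w : ℝ → ℂ} (hw : Measurable w) (hwz : ∀ t, ‖w t‖ ≤ ‖z‖) (s : ℝ) :
    Continuous (fun t => z * exp (-∫ τ in s..max s t, p (w τ) τ)) ∧
      ∀ t, ‖z * exp (-∫ τ in s..max s t, p (w τ) τ)‖ ≤ ‖z‖ := by
  constructor
  · have := (intervalIntegral.continuous_primitive (hp.intervalIntegrable_comp hw hz hwz) s).comp
      (continuous_const.max continuous_id : Continuous fun t : ℝ => max s t)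
    exact continuous_const.mul this.neg.cexp
  · intro t
    rw [norm_mul, Complex.norm_exp]
    refine mul_le_of_le_one_right (norm_nonneg _) (Real.exp_le_one_iff.2 ?_)
    simpa using hp.re_integral_comp_nonneg hw hz hwz (le_max_left s t)

lemma continuous_and_norm_loewnerPicard_le (hp : IsHerglotzFamily p) (s : ℝ) {z : ℂ}
    (hz : ‖z‖ < 1) (n : ℕ) :
    Continuous (fun t => loewnerPicard p s n t z) ∧ ∀ t, ‖loewnerPicard p s n t z‖ ≤ ‖z‖ := by
  induction n with
  | zero => exact ⟨continuous_const, fun _ => le_rfl⟩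
  | succ n ih => exact hp.continuous_and_norm_le_of_picard_step hz ih.1.measurable ih.2 s

lemma differentiableOn_loewnerPicard (hp : IsHerglotzFamily p) (s : ℝ) (n : ℕ) (t : ℝ) :
    DifferentiableOn ℂ (loewnerPicard p s n t) (ball (0 : ℂ) 1) := by
  induction n generalizing t with
  | zero => exact differentiableOn_id
  | succ n ih =>
    refine differentiableOn_id.mul (DifferentiableOn.cexp (DifferentiableOn.neg ?_))
    refine differentiableOn_intervalIntegral_of_norm_le
      (F := fun z τ => p (loewnerPicard p s n τ z) τ) (M := fun r => 4 / (1 - r))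
      (fun τ => ?_) (fun z hz => ?_) (fun r hr z hz τ => ?_) _ _
    · refine (hp.differentiableOn τ).comp (ih τ) fun z hz => ?_
      rw [mem_ball_zero_iff] at hz ⊢
      exact ((hp.continuous_and_norm_loewnerPicard_le s hz n).2 τ).trans_lt hz
    · rw [mem_ball_zero_iff] at hz
      have h := hp.continuous_and_norm_loewnerPicard_le s hz n
      exact hp.measurable_comp h.1.measurable fun τ => (h.2 τ).trans_lt hz
    · exact hp.norm_le hr
        (((hp.continuous_and_norm_loewnerPicard_le s (hz.trans_lt hr) n).2 τ).trans hz) τ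

lemma norm_loewnerPicard_succ_sub_le (hp : IsHerglotzFamily p) (s : ℝ) {r : ℝ} (hr : r < 1)
    {z : ℂ} (hz : ‖z‖ ≤ r) (n : ℕ) (t : ℝ) :
    ‖loewnerPicard p s (n + 1) t z - loewnerPicard p s n t z‖ ≤
      2 * ((16 / (1 - r) ^ 2 * (max s t - s)) ^ n / n.factorial) := by
  have hz1 := hz.trans_lt hr
  have hP := hp.continuous_and_norm_loewnerPicard_le s hz1
  induction n generalizing t with
  | zero =>
    have h1 := ((hP 1).2 t).trans hz1.le
    have h0 := ((hP 0).2 t).trans hz1.le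
    simpa using (_root_.norm_sub_le _ _).trans (by linarith : _ ≤ (2 : ℝ))
  | succ n ih =>
    set K := 16 / (1 - r) ^ 2
    have hst := le_max_left s t
    set T := max s t
    have hint := fun m => hp.intervalIntegrable_comp (hP m).1.measurable hz1 (hP m).2
    have hre := fun m => hp.re_integral_comp_nonneg (hP m).1.measurable hz1 (hP m).2 hst
    have hI : ‖(∫ τ in s..T, p (loewnerPicard p s (n + 1) τ z) τ) -
        ∫ τ in s..T, p (loewnerPicard p s n τ z) τ‖ ≤
        ∫ τ in s..T, K * (2 * ((K * (τ - s)) ^ n / n.factorial)) := by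
      rw [← intervalIntegral.integral_sub (hint (n + 1) _ _) (hint n _ _)]
      refine intervalIntegral.norm_integral_le_of_norm_le hst (.of_forall fun τ hτ => ?_)
        (Continuous.intervalIntegrable (by fun_prop) _ _)
      refine (hp.norm_sub_le hr (((hP (n + 1)).2 τ).trans hz) (((hP n).2 τ).trans hz) τ).trans ?_
      have := ih τ
      rw [max_eq_right hτ.1.le] at this
      gcongr
    have hC : (∫ τ in s..T, K * (2 * ((K * (τ - s)) ^ n / n.factorial))) =
        2 * ((K * (T - s)) ^ (n + 1) / (n + 1).factorial) := by
      rw [intervalIntegral.integral_comp_sub_right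
        (fun x => K * (2 * ((K * x) ^ n / n.factorial))) s]
      simp only [mul_pow, mul_div_assoc, intervalIntegral.integral_const_mul,
        intervalIntegral.integral_div, integral_pow, Nat.factorial_succ]
      push_cast
      field_simp
      simp [pow_succ, mul_comm]
    calc _ = ‖z‖ * ‖exp (-∫ τ in s..T, p (loewnerPicard p s (n + 1) τ z) τ) -
          exp (-∫ τ in s..T, p (loewnerPicard p s n τ z) τ)‖ := by
          rw [← norm_mul, mul_sub]; rfl
      _ ≤ 1 * ‖_‖ := mul_le_mul hz1.le (norm_exp_neg_sub_exp_neg_le (hre (n + 1)) (hre n))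
          (norm_nonneg _) zero_le_one
      _ ≤ _ := by rw [one_mul, ← hC]; exact hI

lemma summable_picard_bound (x : ℝ) : Summable fun n : ℕ => 2 * (x ^ n / n.factorial) :=
  (Real.summable_pow_div_factorial x).mul_left 2

lemma tendsto_loewnerPicard (hp : IsHerglotzFamily p) (s : ℝ) {z : ℂ} (hz : ‖z‖ < 1) (t : ℝ) :
    Tendsto (fun n => loewnerPicard p s n t z) atTop (𝓝 (loewnerFlow p s t z)) := by
  have hs := (Summable.of_norm_bounded (summable_picard_bound _)
    fun n => hp.norm_loewnerPicard_succ_sub_le s hz le_rfl n t).hasSum.tendsto_sum_nat.const_add z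
  refine hs.congr fun n => ?_
  rw [Finset.sum_range_sub (fun n => loewnerPicard p s n t z)]
  exact add_sub_cancel z _

lemma norm_loewnerFlow_le (hp : IsHerglotzFamily p) (s : ℝ) {z : ℂ} (hz : ‖z‖ < 1) (t : ℝ) :
    ‖loewnerFlow p s t z‖ ≤ ‖z‖ :=
  le_of_tendsto (hp.tendsto_loewnerPicard s hz t).norm
    (.of_forall fun n => (hp.continuous_and_norm_loewnerPicard_le s hz n).2 t)

lemma measurable_loewnerFlow (hp : IsHerglotzFamily p) (s : ℝ) {z : ℂ} (hz : ‖z‖ < 1) :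
    Measurable fun t => loewnerFlow p s t z :=
  measurable_of_tendsto_metrizable
    (fun n => (hp.continuous_and_norm_loewnerPicard_le s hz n).1.measurable)
    (tendsto_pi_nhds.2 fun t => hp.tendsto_loewnerPicard s hz t)

lemma differentiableOn_loewnerFlow (hp : IsHerglotzFamily p) (s t : ℝ) :
    DifferentiableOn ℂ (loewnerFlow p s t) (ball (0 : ℂ) 1) := by
  intro z hz
  rw [mem_ball_zero_iff] at hz
  obtain ⟨r, hzr, hr⟩ := exists_between hz
  have hd : DifferentiableOn ℂ (loewnerFlow p s t) (ball (0 : ℂ) r) := by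
    refine differentiableOn_id.add (differentiableOn_tsum_of_summable_norm
      (summable_picard_bound (16 / (1 - r) ^ 2 * (max s t - s))) (fun n => ?_) isOpen_ball
      fun n w hw => hp.norm_loewnerPicard_succ_sub_le s hr (mem_ball_zero_iff.1 hw).le n t)
    exact ((hp.differentiableOn_loewnerPicard s (n + 1) t).sub
      (hp.differentiableOn_loewnerPicard s n t)).mono (ball_subset_ball hr.le)
  exact (hd.differentiableAt (isOpen_ball.mem_nhds (mem_ball_zero_iff.2 hzr))).differentiableWithinAt

lemma loewnerFlow_eq_exp (hp : IsHerglotzFamily p) (s : ℝ) {z : ℂ} (hz : ‖z‖ < 1) (t : ℝ) :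
    loewnerFlow p s t z = z * exp (-∫ τ in s..max s t, p (loewnerFlow p s τ z) τ) := by
  have hP := hp.continuous_and_norm_loewnerPicard_le s hz
  refine tendsto_nhds_unique ((tendsto_add_atTop_iff_nat 1).2 (hp.tendsto_loewnerPicard s hz t)) ?_
  have hI : Tendsto (fun n => ∫ τ in s..max s t, p (loewnerPicard p s n τ z) τ) atTop
      (𝓝 (∫ τ in s..max s t, p (loewnerFlow p s τ z) τ)) := by
    refine intervalIntegral.tendsto_integral_filter_of_dominated_convergence
      (fun _ => 4 / (1 - ‖z‖)) (.of_forall fun n => ?_) (.of_forall fun n => ?_)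
      intervalIntegrable_const (.of_forall fun τ _ => ?_)
    · exact (hp.measurable_comp (hP n).1.measurable
        fun τ => ((hP n).2 τ).trans_lt hz).aestronglyMeasurable
    · exact .of_forall fun τ _ => hp.norm_le hz ((hP n).2 τ) τ
    · have hc : ContinuousAt (fun w => p w τ) (loewnerFlow p s τ z) :=
        (hp.differentiableOn τ).continuousOn.continuousAt (isOpen_ball.mem_nhds
          (mem_ball_zero_iff.2 ((hp.norm_loewnerFlow_le s hz τ).trans_lt hz)))
      exact hc.tendsto.comp (hp.tendsto_loewnerPicard s hz τ)
  exact hI.neg.cexp.const_mul z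

lemma continuous_loewnerFlow (hp : IsHerglotzFamily p) (s : ℝ) {z : ℂ} (hz : ‖z‖ < 1) :
    Continuous fun t => loewnerFlow p s t z := by
  have := (hp.continuous_and_norm_le_of_picard_step hz (hp.measurable_loewnerFlow s hz)
    (hp.norm_loewnerFlow_le s hz) s).1
  exact this.congr fun t => (hp.loewnerFlow_eq_exp s hz t).symm

lemma loewnerFlow_eq_sub_integral (hp : IsHerglotzFamily p) {s t : ℝ} (hst : s ≤ t) {z : ℂ}
    (hz : ‖z‖ < 1) :
    loewnerFlow p s t z = z - ∫ τ in s..t, loewnerFlow p s τ z * p (loewnerFlow p s τ z) τ := by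
  have hlt := fun τ => (hp.norm_loewnerFlow_le s hz τ).trans_lt hz
  have h := exp_neg_integral_eq_one_sub_integral (q := fun τ => p (loewnerFlow p s τ z) τ)
    (hp.measurable_comp (hp.measurable_loewnerFlow s hz) hlt)
    (fun τ => hp.norm_le hz (hp.norm_loewnerFlow_le s hz τ) τ)
    (fun τ => (hp.re_pos τ _ (mem_ball_zero_iff.2 (hlt τ))).le) hst
  have hcongr : ∀ τ ∈ uIcc s t, loewnerFlow p s τ z * p (loewnerFlow p s τ z) τ =
      z * (exp (-∫ σ in s..τ, p (loewnerFlow p s σ z) σ) * p (loewnerFlow p s τ z) τ) := by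
    intro τ hτ
    rw [uIcc_of_le hst] at hτ
    nth_rewrite 1 [hp.loewnerFlow_eq_exp s hz τ]
    rw [max_eq_right hτ.1, mul_assoc]
  rw [intervalIntegral.integral_congr hcongr, intervalIntegral.integral_const_mul,
    hp.loewnerFlow_eq_exp s hz t, max_eq_right hst, h]
  ring

lemma loewnerFlow_self (hp : IsHerglotzFamily p) (s : ℝ) {z : ℂ} (hz : ‖z‖ < 1) :
    loewnerFlow p s s z = z := by
  simpa using hp.loewnerFlow_eq_sub_integral le_rfl hz

lemma solvesRadialLoewner_loewnerFlow (hp : IsHerglotzFamily p) (s : ℝ) :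
    SolvesRadialLoewner p s (loewnerFlow p s) := by
  refine ⟨fun t _ => ⟨fun z hz => ?_, hp.differentiableOn_loewnerFlow s t⟩, fun z hz t hst =>
    hp.loewnerFlow_eq_sub_integral hst (mem_ball_zero_iff.1 hz)⟩
  rw [mem_ball_zero_iff] at hz ⊢
  exact (hp.norm_loewnerFlow_le s hz t).trans_lt hz

lemma injOn_loewnerFlow (hp : IsHerglotzFamily p) {s t : ℝ} (hst : s ≤ t) :
    InjOn (loewnerFlow p s t) (ball (0 : ℂ) 1) := by
  intro z hz w hw h
  rw [mem_ball_zero_iff] at hz hw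
  have heq : ∀ {x : ℂ}, ‖x‖ < 1 → ∀ τ ∈ Icc s t, loewnerFlow p s τ x = loewnerFlow p s s x -
      ∫ σ in s..τ, loewnerFlow p s σ x * p (loewnerFlow p s σ x) σ := fun hx τ hτ => by
    rw [hp.loewnerFlow_self s hx]
    exact hp.loewnerFlow_eq_sub_integral hτ.1 hx
  have := hp.eq_left_of_eq_right hst (max_lt hz hw) (hp.continuous_loewnerFlow s hz)
    (hp.continuous_loewnerFlow s hw)
    (fun τ => (hp.norm_loewnerFlow_le s hz τ).trans (le_max_left _ _))
    (fun τ => (hp.norm_loewnerFlow_le s hw τ).trans (le_max_right _ _)) (heq hz) (heq hw) h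
  rwa [hp.loewnerFlow_self s hz, hp.loewnerFlow_self s hw] at this

lemma loewnerFlow_comp (hp : IsHerglotzFamily p) {s t u : ℝ} (hst : s ≤ t) (htu : t ≤ u) {z : ℂ}
    (hz : ‖z‖ < 1) : loewnerFlow p s u z = loewnerFlow p t u (loewnerFlow p s t z) := by
  have hle := hp.norm_loewnerFlow_le s hz
  have hlt := (hle t).trans_lt hz
  have hint := hp.intervalIntegrable_mul_comp (hp.measurable_loewnerFlow s hz) hz hle
  refine hp.eqOn_of_eq_left (a := t) (b := u) hz (hp.continuous_loewnerFlow s hz)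
    (hp.continuous_loewnerFlow t hlt) hle
    (fun τ => (hp.norm_loewnerFlow_le t hlt τ).trans (hle t)) (fun τ hτ => ?_) (fun τ hτ => ?_)
    (hp.loewnerFlow_self t hlt).symm ⟨htu, le_rfl⟩
  · rw [hp.loewnerFlow_eq_sub_integral (hst.trans hτ.1) hz, hp.loewnerFlow_eq_sub_integral hst hz,
      ← intervalIntegral.integral_interval_sub_left (hint s τ) (hint s t)]
    ring
  · rw [hp.loewnerFlow_self t hlt]
    exact hp.loewnerFlow_eq_sub_integral hτ.1 hlt

/-- A solution agrees with the flow up to every time at which its integrand is integrable. -/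
lemma eq_loewnerFlow_of_intervalIntegrable (hp : IsHerglotzFamily p) {s t : ℝ} (hst : s ≤ t)
    {h : ℝ → ℂ → ℂ} (hh : SolvesRadialLoewner p s h) {z : ℂ} (hz : ‖z‖ < 1)
    (hint : IntervalIntegrable (fun τ => h τ z * p (h τ z) τ) volume s t) :
    h t z = loewnerFlow p s t z := by
  have hzb := mem_ball_zero_iff.2 hz
  have hcont : ContinuousOn (fun τ => h τ z) (Icc s t) := by
    have := intervalIntegral.continuousOn_primitive_interval' hint left_mem_uIcc
    rw [uIcc_of_le hst] at this
    exact (continuousOn_const.sub this).congr fun τ hτ => hh.2 z hzb τ hτ.1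
  obtain ⟨x, hx, hmax⟩ := isCompact_Icc.exists_isMaxOn (nonempty_Icc.2 hst) hcont.norm
  have hx1 : ‖h x z‖ < 1 := mem_ball_zero_iff.1 ((hh.1 x hx.1).1 hzb)
  set w : ℝ → ℂ := IccExtend hst ((Icc s t).domRestrict fun τ => h τ z)
  have hwh : ∀ τ ∈ Icc s t, w τ = h τ z := fun τ hτ => IccExtend_of_mem hst _ hτ
  have hs : h s z = z := by simpa using hh.2 z hzb s le_rfl
  have hws := hwh s ⟨le_rfl, hst⟩
  have := hp.eqOn_of_eq_left (v := w) (a := s) (b := t) (max_lt hx1 hz)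
    (continuousOn_iff_continuous_domRestrict.1 hcont).Icc_extend'
    (hp.continuous_loewnerFlow s hz)
    (fun τ => (hmax (projIcc s t hst τ).2).trans (le_max_left _ _))
    (fun τ => (hp.norm_loewnerFlow_le s hz τ).trans (le_max_right _ _))
    (fun τ hτ => ?_)
    (fun τ hτ => by
      rw [hp.loewnerFlow_self s hz]
      exact hp.loewnerFlow_eq_sub_integral hτ.1 hz)
    (by rw [hws, hs, hp.loewnerFlow_self s hz]) ⟨hst, le_rfl⟩
  · rwa [hwh t ⟨hst, le_rfl⟩] at this
  · rw [hws, hs, hwh τ hτ, hh.2 z hzb τ hτ.1]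
    congr 1
    refine intervalIntegral.integral_congr fun σ hσ => ?_
    rw [uIcc_of_le hτ.1] at hσ
    simp only [hwh σ ⟨hσ.1, hσ.2.trans hτ.2⟩]

lemma intervalIntegrable_of_solvesRadialLoewner (hp : IsHerglotzFamily p) {s t : ℝ} (hst : s ≤ t)
    {h : ℝ → ℂ → ℂ} (hh : SolvesRadialLoewner p s h) {z : ℂ} (hz : ‖z‖ < 1) :
    IntervalIntegrable (fun τ => h τ z * p (h τ z) τ) volume s t := by
  classical
  set S : Set ℝ :=
    {τ | s ≤ τ ∧ IntervalIntegrable (fun σ => h σ z * p (h σ z) σ) volume s τ}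
  have hSm : MeasurableSet S := by
    refine (ordConnected_iff.2 fun x hx y hy _ τ hτ => ?_ : S.OrdConnected).measurableSet
    have hsτ := hx.1.trans hτ.1
    exact ⟨hsτ, hy.2.mono_set (by
      rw [uIcc_of_le hsτ, uIcc_of_le hy.1]
      exact Icc_subset_Icc_right hτ.2)⟩
  set w : ℝ → ℂ := S.piecewise (fun τ => loewnerFlow p s τ z) fun _ => z with hw
  have hwm : Measurable w := (hp.measurable_loewnerFlow s hz).piecewise hSm measurable_const
  have hwz : ∀ τ, ‖w τ‖ ≤ ‖z‖ := fun τ => by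
    by_cases hτ : τ ∈ S
    · simpa [hw, hτ] using hp.norm_loewnerFlow_le s hz τ
    · simp [hw, hτ]
  have hwh : ∀ τ, s ≤ τ → h τ z = w τ := fun τ hsτ => by
    by_cases hτ : τ ∈ S
    · simpa [hw, hτ] using hp.eq_loewnerFlow_of_intervalIntegrable hsτ hh hz hτ.2
    · rw [hh.2 z (mem_ball_zero_iff.2 hz) τ hsτ,
        intervalIntegral.integral_undef fun hi => hτ ⟨hsτ, hi⟩]
      simp [hw, hτ]
  refine (hp.intervalIntegrable_mul_comp hwm hz hwz s t).congr fun τ hτ => ?_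
  rw [uIoc_of_le hst] at hτ
  simp only [hwh τ hτ.1.le]

lemma eqOn_loewnerFlow (hp : IsHerglotzFamily p) {s t : ℝ} (hst : s ≤ t)
    {h : ℝ → ℂ → ℂ} (hh : SolvesRadialLoewner p s h) :
    EqOn (h t) (loewnerFlow p s t) (ball (0 : ℂ) 1) := fun _ hz =>
  hp.eq_loewnerFlow_of_intervalIntegrable hst hh (mem_ball_zero_iff.1 hz)
    (hp.intervalIntegrable_of_solvesRadialLoewner hst hh (mem_ball_zero_iff.1 hz))

end IsHerglotzFamily

/-- A family that is Herglotz for almost every time agrees for almost every time with a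
Herglotz family. -/
lemma exists_isHerglotzFamily {p : ℂ → ℝ → ℂ}
    (hp_ae : ∀ᵐ t ∂(volume.restrict (Ici (0 : ℝ))),
      DifferentiableOn ℂ (fun z => p z t) (ball (0 : ℂ) 1) ∧
      (∀ z ∈ ball (0 : ℂ) 1, 0 < (p z t).re) ∧ p 0 t = 1)
    (hp_meas : ∀ z ∈ ball (0 : ℂ) 1, Measurable fun t => p z t) :
    ∃ q, IsHerglotzFamily q ∧
      ∀ᵐ t ∂(volume.restrict (Ici (0 : ℝ))), ∀ z, p z t = q z t := by
  classical
  obtain ⟨S, hS, hSm, hSp⟩ := hp_ae.exists_measurable_mem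
  refine ⟨fun z t => if t ∈ S then p z t else 1, ⟨fun t => ?_, fun t z hz => ?_, fun t => ?_,
    fun z hz => (hp_meas z hz).ite hSm measurable_const⟩, ?_⟩
  · by_cases ht : t ∈ S
    · simpa only [ht, if_true] using (hSp t ht).1
    · simpa only [ht, if_false] using differentiableOn_const 1
  · by_cases ht : t ∈ S
    · simpa only [ht, if_true] using (hSp t ht).2.1 z hz
    · simp [ht]
  · by_cases ht : t ∈ S
    · simpa only [ht, if_true] using (hSp t ht).2.2
    · simp [ht]
  · filter_upwards [hS] with t ht z
    rw [if_pos ht]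

lemma solvesRadialLoewner_congr {p q : ℂ → ℝ → ℂ} {s : ℝ} (hs : 0 ≤ s)
    (hpq : ∀ᵐ t ∂(volume.restrict (Ici (0 : ℝ))), ∀ z, p z t = q z t) {g : ℝ → ℂ → ℂ} :
    SolvesRadialLoewner p s g ↔ SolvesRadialLoewner q s g := by
  refine and_congr_right fun _ => forall₂_congr fun z _ => forall₂_congr fun t hst => ?_
  rw [intervalIntegral.integral_congr_ae (g := fun τ => g τ z * q (g τ z) τ)]
  rw [ae_restrict_iff' measurableSet_Ici] at hpq
  filter_upwards [hpq] with τ hτ hmem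
  rw [uIoc_of_le hst] at hmem
  rw [hτ (hs.trans hmem.1.le)]

/-- Radial Loewner ordinary differential equation: for a measurable Herglotz family `p`
there is, for each initial time `s ≥ 0`, a unique solution family `(g_{s,t})_{t ≥ s}` of
holomorphic self-maps of the disc; moreover every `g_{s,t}` is injective and the
solutions satisfy the transition relation `g_{s,u} = g_{t,u} ∘ g_{s,t}`. -/
theorem radial_loewner_ODE
    (p : ℂ → ℝ → ℂ)
    (hp_ae : ∀ᵐ t ∂(volume.restrict (Set.Ici (0 : ℝ))),
      DifferentiableOn ℂ (fun z => p z t) (Metric.ball (0 : ℂ) 1) ∧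
      (∀ z ∈ Metric.ball (0 : ℂ) 1, 0 < (p z t).re) ∧
      p 0 t = 1)
    (hp_meas : ∀ z ∈ Metric.ball (0 : ℂ) 1, Measurable fun t => p z t) :
    ∃ g : ℝ → ℝ → ℂ → ℂ,
      (∀ s : ℝ, 0 ≤ s → SolvesRadialLoewner p s (g s)) ∧
      (∀ s : ℝ, 0 ≤ s → ∀ h : ℝ → ℂ → ℂ, SolvesRadialLoewner p s h →
        ∀ t : ℝ, s ≤ t → Set.EqOn (h t) (g s t) (Metric.ball (0 : ℂ) 1)) ∧
      (∀ s t : ℝ, 0 ≤ s → s ≤ t → Set.InjOn (g s t) (Metric.ball (0 : ℂ) 1)) ∧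
      (∀ s t u : ℝ, 0 ≤ s → s ≤ t → t ≤ u →
        ∀ z ∈ Metric.ball (0 : ℂ) 1, g s u z = g t u (g s t z)) := by
  obtain ⟨q, hq, hpq⟩ := exists_isHerglotzFamily hp_ae hp_meas
  refine ⟨loewnerFlow q, fun s hs => ?_, fun s hs h hh t hst => ?_, fun s t _ hst => ?_,
    fun s t u _ hst htu z hz => ?_⟩
  · exact (solvesRadialLoewner_congr hs hpq).2 (hq.solvesRadialLoewner_loewnerFlow s)
  · exact hq.eqOn_loewnerFlow hst ((solvesRadialLoewner_congr hs hpq).1 hh)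
  · exact hq.injOn_loewnerFlow hst
  · exact hq.loewnerFlow_comp hst htu (mem_ball_zero_iff.1 hz)
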